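/- arXiv:1811.00428 — 3 statements merged into one kernel-verified Lean document; each statement's English description precedes it below -/
import Mathlib

section
/- For every finite set X equipped with an action of G_ℚ such that the stabilizer of every point of X is an open subgroup of G_ℚ, there exist a finite étale ℚ-algebra B and a G_ℚ-equivariant bijection between X and Hom_{ℚ-alg}(B, ℚ̄). -/
/-- `ℚ̄`, the algebraic closure of `ℚ` in `ℂ`. -/
noncomputable abbrev Qbar : IntermediateField ℚ ℂ := algebraicClosure ℚ ℂ

/-- A finite étale `ℚ`-algebra: a commutative `ℚ`-algebra that is finite-dimensional
as a `ℚ`-vector space and reduced. -/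
structure FiniteEtaleQAlgebra where
  carrier : Type
  [commRing : CommRing carrier]
  [alg : Algebra ℚ carrier]
  finite : FiniteDimensional ℚ carrier
  reduced : IsReduced carrier

attribute [instance] FiniteEtaleQAlgebra.commRing FiniteEtaleQAlgebra.alg

theorem galois_set_aux {k K : Type} [Field k] [Field K] [Algebra k K] [IsGalois k K]
    (X : Type) [Finite X] [MulAction (K ≃ₐ[k] K) X]
    (hopen : ∀ x : X,
      IsOpen ((MulAction.stabilizer (K ≃ₐ[k] K) x : Subgroup (K ≃ₐ[k] K)) :
        Set (K ≃ₐ[k] K))) :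
    ∃ (B : Type) (_ : CommRing B) (_ : Algebra k B), FiniteDimensional k B ∧ IsReduced B ∧
      ∃ e : X ≃ (B →ₐ[k] K),
      ∀ (g : K ≃ₐ[k] K) (x : X), e (g • x) = g.toAlgHom.comp (e x) := by
  classical
  let Ω := MulAction.orbitRel.Quotient (K ≃ₐ[k] K) X
  have : Finite Ω := Quotient.finite _
  have : Fintype Ω := Fintype.ofFinite _
  let r : Ω → X := fun ω => Quotient.out ω
  let p : X → Ω := fun x => Quotient.mk'' x
  have hpr : ∀ ω, p (r ω) = ω := fun ω => Quotient.out_eq' ω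
  have hpg : ∀ (g : K ≃ₐ[k] K) x, p (g • x) = p x := fun g x =>
    Quotient.sound' (MulAction.mem_orbit x g)
  have hex : ∀ x : X, ∃ g : K ≃ₐ[k] K, g • r (p x) = x := by
    intro x
    have h : p x = p (r (p x)) := (hpr _).symm
    have h2 := Quotient.exact' h
    exact h2
  choose γ hγ using hex
  let F : Ω → IntermediateField k K := fun ω =>
    IntermediateField.fixedField (MulAction.stabilizer (K ≃ₐ[k] K) (r ω))
  have hfix : ∀ ω, (F ω).fixingSubgroup = MulAction.stabilizer (K ≃ₐ[k] K) (r ω) := fun ω =>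
    InfiniteGalois.fixingSubgroup_fixedField
      ⟨MulAction.stabilizer (K ≃ₐ[k] K) (r ω), Subgroup.isClosed_of_isOpen _ (hopen _)⟩
  have hfd : ∀ ω, FiniteDimensional k (F ω) := by
    intro ω
    rw [← InfiniteGalois.isOpen_iff_finite, hfix]
    exact hopen _
  have hmem : ∀ ω (g : K ≃ₐ[k] K), g • r ω = r ω ↔ ∀ a : F ω, g a = a := by
    intro ω g
    rw [← MulAction.mem_stabilizer_iff, ← hfix, IntermediateField.mem_fixingSubgroup_iff]
    simp
  have hmem2 : ∀ ω (g h : K ≃ₐ[k] K), g • r ω = h • r ω ↔ ∀ a : F ω, g a = h a := by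
    intro ω g h
    rw [← inv_smul_eq_iff.trans (Iff.rfl : g • r ω = h • r ω ↔ _), smul_smul, hmem]
    refine forall_congr' fun a => ?_
    rw [AlgEquiv.mul_apply, AlgEquiv.aut_inv, AlgEquiv.symm_apply_eq]
  let f : X → (((ω : Ω) → F ω) →ₐ[k] K) := fun x =>
    ((γ x).toAlgHom.comp (F (p x)).val).comp (Pi.evalAlgHom k (fun ω => F ω) (p x))
  have hf : ∀ x b, f x b = γ x (b (p x)) := fun x b => rfl
  have key : ∀ ω (g : K ≃ₐ[k] K) b, f (g • r ω) b = g (b ω) := by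
    intro ω g b
    have h1 : p (g • r ω) = ω := by rw [hpg, hpr]
    rw [hf]
    have h2 := hγ (g • r ω)
    generalize γ (g • r ω) = δ at *
    generalize p (g • r ω) = ω' at *
    subst h1
    exact (hmem2 _ _ _).1 h2 _
  have hbij : Function.Bijective f := by
    constructor
    · intro x y hxy
      have hp : p x = p y := by
        by_contra hne
        have := DFunLike.congr_fun hxy (Pi.single (p x) 1)
        rw [hf, hf, Pi.single_eq_same, Pi.single_eq_of_ne (Ne.symm hne)] at this
        simp at this
      rw [← hγ x, ← hγ y, ← hp, hmem2]
      intro a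
      have := DFunLike.congr_fun hxy (Pi.single (p x) a)
      have hy : γ y • r (p x) = y := by rw [hp, hγ]
      have k1 := key (p x) (γ x) (Pi.single (p x) a)
      have k2 := key (p x) (γ y) (Pi.single (p x) a)
      rw [hγ x, Pi.single_eq_same] at k1
      rw [hy, Pi.single_eq_same] at k2
      rw [← k1, ← k2, this]
    · intro φ
      have h1 : ∑ ω, φ (Pi.single ω 1) = 1 := by
        rw [← map_sum, ← map_one φ]
        congr 1
        exact Finset.univ_sum_single (1 : (ω : Ω) → F ω)
      obtain ⟨ω, -, hω⟩ := Finset.exists_ne_zero_of_sum_ne_zero (h1.trans_ne one_ne_zero)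
      have hω1 : φ (Pi.single ω 1) = 1 := by
        have : φ (Pi.single ω 1) * φ (Pi.single ω 1) = φ (Pi.single ω 1) := by
          rw [← map_mul, ← Pi.single_mul, one_mul]
        exact (mul_eq_left₀ hω).1 this
      have hφ : ∀ b, φ b = φ (Pi.single ω (b ω)) := by
        intro b
        have : (Pi.single ω (b ω) : (ω : Ω) → F ω) = b * Pi.single ω 1 := by
          rw [← Pi.single_mul_right, mul_one]
        rw [this, map_mul, hω1, mul_one]
      let ψ : F ω →ₐ[k] K := AlgHom.ofLinearMap
        (φ.toLinearMap.comp (LinearMap.single k (fun ω => F ω) ω)) hω1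
        (by
          intro a b
          change φ (Pi.single ω (a * b)) = φ (Pi.single ω a) * φ (Pi.single ω b)
          rw [← map_mul, ← Pi.single_mul])
      let σ := ψ.liftNormal K
      have hσ : ∀ a : F ω, σ a = ψ a := fun a => ψ.liftNormal_commutes K a
      let τ := AlgEquiv.ofBijective σ (Algebra.IsAlgebraic.algHom_bijective σ)
      refine ⟨τ • r ω, ?_⟩
      ext b
      rw [key, hφ]
      exact hσ _
  refine ⟨(ω : Ω) → F ω, inferInstance, inferInstance, inferInstance, inferInstance, Equiv.ofBijective f hbij, ?_⟩
  intro g x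
  change f (g • x) = g.toAlgHom.comp (f x)
  ext b
  change f (g • x) b = g (f x b)
  rw [← hγ x, smul_smul, key, key]
  rfl

set_option synthInstance.maxHeartbeats 1000000 in
/-- **Every finite `G_ℚ`-set with open stabilizers comes from a finite étale `ℚ`-algebra.**
For every finite set `X` with an action of `G_ℚ = Gal(ℚ̄/ℚ)` (with its Krull topology)
such that all point stabilizers are open, there are a finite étale `ℚ`-algebra `B` and a
`G_ℚ`-equivariant bijection `X ≃ Hom_{ℚ-alg}(B, ℚ̄)`, where `G_ℚ` acts on homomorphisms
by post-composition. -/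
theorem exists_finiteEtaleAlgebra_of_galois_set
    (X : Type) [Finite X] [MulAction (Qbar ≃ₐ[ℚ] Qbar) X]
    (hopen : ∀ x : X,
      IsOpen ((MulAction.stabilizer (Qbar ≃ₐ[ℚ] Qbar) x : Subgroup (Qbar ≃ₐ[ℚ] Qbar)) :
        Set (Qbar ≃ₐ[ℚ] Qbar))) :
    ∃ B : FiniteEtaleQAlgebra, ∃ e : X ≃ (B.carrier →ₐ[ℚ] Qbar),
      ∀ (g : Qbar ≃ₐ[ℚ] Qbar) (x : X), e (g • x) = g.toAlgHom.comp (e x) := by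
  have h0 : IsAlgClosure ℚ Qbar := algebraicClosure.isAlgClosure ℚ ℂ
  have h1 : IsGalois ℚ Qbar := IsAlgClosure.isGalois ℚ Qbar
  obtain ⟨B, _, _, h2, h3, e, he⟩ := galois_set_aux (k := ℚ) X hopen
  exact ⟨⟨B, h2, h3⟩, e, he⟩
end

section
/- Let E be a CM field and Φ a CM type of E, viewed as a set of embeddings E → ℚ̄, and let Stab(Φ) = {g ∈ G_ℚ : g∘Φ = Φ} be its stabilizer in G_ℚ. Then the fixed field E' = {x ∈ ℚ̄ : σ(x) = x for all σ ∈ Stab(Φ)} is a finite extension of ℚ that is itself a CM field: it is totally imaginary and is a degree-2 extension of a totally real subfield. -/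
open scoped Pointwise

/-- Complex conjugation, as a `ℚ`-algebra homomorphism `ℂ → ℂ`. -/
noncomputable def conjC : ℂ →ₐ[ℚ] ℂ :=
  ((Complex.conjAe.restrictScalars ℚ).toAlgHom)

/-- Complex conjugation restricted to `ℚ̄ ⊂ ℂ`. -/
noncomputable def qbarConj : Qbar →ₐ[ℚ] Qbar where
  toFun x := ⟨conjC x, mem_algebraicClosure_iff'.mpr
    ((mem_algebraicClosure_iff'.mp x.2).map conjC)⟩
  map_one' := Subtype.ext (by simp)
  map_mul' x y := Subtype.ext (by simp)
  map_zero' := Subtype.ext (by simp)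
  map_add' x y := Subtype.ext (by simp)
  commutes' q := Subtype.ext (by simp [IntermediateField.algebraMap_apply])

/-- The action of `G_ℚ = Gal(ℚ̄/ℚ)` on embeddings `E → ℚ̄`, by post-composition. -/
noncomputable instance algHomGaloisAction (E : Type*) [Field E] [Algebra ℚ E] :
    MulAction (Qbar ≃ₐ[ℚ] Qbar) (E →ₐ[ℚ] Qbar) where
  smul g φ := g.toAlgHom.comp φ
  one_smul φ := AlgHom.ext fun _ => rfl
  mul_smul g h φ := AlgHom.ext fun _ => rfl

open scoped ComplexConjugate

theorem qbarConj_coe (x : Qbar) : ((qbarConj x : Qbar) : ℂ) = conj (x : ℂ) := rfl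

theorem qbarConj_invol (x : Qbar) : qbarConj (qbarConj x) = x :=
  Subtype.ext (by rw [qbarConj_coe, qbarConj_coe, Complex.conj_conj])

noncomputable def qbarC : Qbar ≃ₐ[ℚ] Qbar :=
  AlgEquiv.ofAlgHom qbarConj qbarConj (AlgHom.ext qbarConj_invol) (AlgHom.ext qbarConj_invol)

theorem qbarC_apply (x : Qbar) : qbarC x = qbarConj x := rfl

instance qbar_isAlgebraic : Algebra.IsAlgebraic ℚ Qbar :=
  algebraicClosure.isAlgebraic ℚ ℂ

instance qbar_isAlgClosure : IsAlgClosure ℚ Qbar :=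
  algebraicClosure.isAlgClosure ℚ ℂ

instance qbar_isGalois : IsGalois ℚ Qbar :=
  have : Normal ℚ Qbar := IsAlgClosure.normal ℚ Qbar
  { }

theorem isReal_iff_exists {K : Type*} [Field K] (ψ : K →+* ℂ) :
    NumberField.ComplexEmbedding.IsReal ψ ↔ ∀ x, ∃ r : ℝ, ψ x = (r : ℂ) := by
  rw [NumberField.ComplexEmbedding.isReal_iff, RingHom.ext_iff]
  refine forall_congr' fun x => ?_
  rw [NumberField.ComplexEmbedding.conjugate_coe_eq, Complex.conj_eq_iff_real]

/-- extension of embeddings to automorphisms of `ℚ̄` -/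
theorem exists_gal_extend (L : IntermediateField ℚ Qbar) (ψ : L →+* ℂ) :
    ∃ g : Qbar ≃ₐ[ℚ] Qbar, ∀ x : L, ψ x = ((g (x : Qbar) : Qbar) : ℂ) := by
  obtain ⟨τ, hτ⟩ := IsAlgClosed.surjective_domRestrict_of_isAlgebraic
    (K := ℚ) (L := L) (M := ℂ) (E := Qbar) ψ.toRatAlgHom
  have hmem : ∀ x : Qbar, τ x ∈ Qbar := fun x =>
    mem_algebraicClosure_iff'.mpr ((Algebra.IsIntegral.isIntegral (R := ℚ) x).map τ)
  let τ' : Qbar →ₐ[ℚ] Qbar := τ.codRestrict Qbar.toSubalgebra hmem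
  refine ⟨AlgEquiv.ofBijective τ' (Algebra.IsAlgebraic.algHom_bijective τ'), fun x => ?_⟩
  exact (DFunLike.congr_fun hτ x).symm

theorem conj_comm (E : Type*) [Field E] [NumberField E]
    (F : IntermediateField ℚ E)
    (hFreal : ∀ ψ : F →+* ℂ, ∀ x : F, ∃ r : ℝ, ψ x = (r : ℂ))
    (hEimag : ∀ ψ : E →+* ℂ, ∃ x : E, ∀ r : ℝ, ψ x ≠ (r : ℂ))
    (hEF : Module.finrank F E = 2) :
    ∃ σ : E → E, ∀ (φ : E →ₐ[ℚ] Qbar) (x : E), φ (σ x) = qbarC (φ x) := by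
  have h1 : NumberField.IsTotallyReal F := ⟨fun w => by
    rw [← NumberField.InfinitePlace.mk_embedding w, NumberField.InfinitePlace.isReal_mk_iff,
      isReal_iff_exists]
    exact hFreal _⟩
  have h2 : NumberField.IsTotallyComplex E := ⟨fun w => by
    rw [← NumberField.InfinitePlace.mk_embedding w, NumberField.InfinitePlace.isComplex_mk_iff,
      isReal_iff_exists]
    intro h
    obtain ⟨x, hx⟩ := hEimag w.embedding
    obtain ⟨r, hr⟩ := h x
    exact hx r hr⟩
  have h3 : Algebra.IsQuadraticExtension F E := ⟨hEF⟩
  have h4 : NumberField.IsCMField E := NumberField.IsCMField.ofCMExtension F E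
  refine ⟨NumberField.IsCMField.complexConj E, fun φ x => Subtype.ext ?_⟩
  exact NumberField.IsCMField.complexEmbedding_complexConj E
    ((algebraMap Qbar ℂ).comp (φ : E →+* Qbar)) x

theorem smul_emb_apply {E : Type*} [Field E] [Algebra ℚ E] (g : Qbar ≃ₐ[ℚ] Qbar)
    (φ : E →ₐ[ℚ] Qbar) (x : E) : (g • φ) x = g (φ x) := rfl

theorem mem_stab_of_fix {E : Type*} [Field E] [Algebra ℚ E] (Φ : Set (E →ₐ[ℚ] Qbar))
    (g : Qbar ≃ₐ[ℚ] Qbar) (h : ∀ (φ : E →ₐ[ℚ] Qbar) x, g (φ x) = φ x) :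
    g ∈ MulAction.stabilizer (Qbar ≃ₐ[ℚ] Qbar) Φ := by
  have hs : ∀ φ : E →ₐ[ℚ] Qbar, g • φ = φ := fun φ => AlgHom.ext (h φ)
  rw [MulAction.mem_stabilizer_iff]
  ext φ
  rw [Set.mem_smul_set]
  simp [hs]

set_option synthInstance.maxHeartbeats 1000000 in
/-- **The reflex field of a CM pair is a CM field.**
`E` is a CM field (a totally imaginary quadratic extension of a totally real field `F`),
`Φ` is a CM type of `E` (a set of embeddings `E → ℚ̄` with `Φ ⊔ Φ̄` equal to all embeddings),
and `E'` is the fixed field in `ℚ̄` of the stabilizer of `Φ` in `G_ℚ = Gal(ℚ̄/ℚ)`.  Then `E'`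
is finite over `ℚ`, totally imaginary, and a degree-2 extension of a totally real subfield. -/
theorem reflex_field_is_CM
    (E : Type*) [Field E] [NumberField E]
    (F : IntermediateField ℚ E)
    (hFreal : ∀ ψ : F →+* ℂ, ∀ x : F, ∃ r : ℝ, ψ x = (r : ℂ))
    (hEimag : ∀ ψ : E →+* ℂ, ∃ x : E, ∀ r : ℝ, ψ x ≠ (r : ℂ))
    (hEF : Module.finrank F E = 2)
    (Φ : Set (E →ₐ[ℚ] Qbar))
    (hΦ : ∀ φ : E →ₐ[ℚ] Qbar, φ ∈ Φ ↔ qbarConj.comp φ ∉ Φ)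
    (E' : IntermediateField ℚ Qbar)
    (hE' : E' = IntermediateField.fixedField
      (MulAction.stabilizer (Qbar ≃ₐ[ℚ] Qbar) Φ)) :
    FiniteDimensional ℚ E' ∧
      (∀ ψ : ↥E' →+* ℂ, ∃ x : ↥E', ∀ r : ℝ, ψ x ≠ (r : ℂ)) ∧
      ∃ F' : IntermediateField ℚ ↥E',
        (∀ ψ : ↥F' →+* ℂ, ∀ x : ↥F', ∃ r : ℝ, ψ x = (r : ℂ)) ∧
        Module.finrank ↥F' ↥E' = 2 := by
  classical
  obtain ⟨σ, hσ⟩ := conj_comm E F hFreal hEimag hEF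
  set H := MulAction.stabilizer (Qbar ≃ₐ[ℚ] Qbar) Φ with hH
  have hfix : ∀ x ∈ E', ∀ h ∈ H, h x = x := by
    intro x hx h hh
    rw [hE', IntermediateField.mem_fixedField_iff] at hx
    exact hx h hh
  have hcomm : ∀ (g : Qbar ≃ₐ[ℚ] Qbar), ∀ x ∈ E', qbarC (g x) = g (qbarC x) := by
    intro g x hx
    have hk : (qbarC * g)⁻¹ * (g * qbarC) ∈ H := by
      refine mem_stab_of_fix Φ _ fun φ x => ?_
      have h1 : (g * qbarC) (φ x) = (qbarC * g) (φ x) := by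
        change g (qbarC (φ x)) = qbarC (g (φ x))
        rw [← hσ, ← smul_emb_apply, hσ, smul_emb_apply]
      rw [AlgEquiv.mul_apply, h1, ← AlgEquiv.mul_apply, inv_mul_cancel, AlgEquiv.one_apply]
    have h2 := hfix x hx _ hk
    have h3 := congrArg (qbarC * g) h2
    rw [← AlgEquiv.mul_apply, mul_inv_cancel_left] at h3
    exact h3.symm
  have hcE : ∀ x ∈ E', qbarC x ∈ E' := by
    intro x hx
    rw [hE', IntermediateField.mem_fixedField_iff]
    intro h hh
    rw [← hcomm h x hx, hfix x hx h hh]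
  -- finiteness
  let K : IntermediateField ℚ Qbar := ⨆ φ : E →ₐ[ℚ] Qbar, φ.fieldRange
  have hφfin : ∀ φ : E →ₐ[ℚ] Qbar, FiniteDimensional ℚ φ.fieldRange := fun φ =>
    inferInstanceAs (FiniteDimensional ℚ (LinearMap.range φ.toLinearMap))
  have hKfin : FiniteDimensional ℚ K := IntermediateField.finiteDimensional_iSup_of_finite
  have hKH : K.fixingSubgroup ≤ H := by
    intro g hg
    rw [IntermediateField.mem_fixingSubgroup_iff] at hg
    refine mem_stab_of_fix Φ _ fun φ x => hg _ ?_
    exact (le_iSup (fun φ : E →ₐ[ℚ] Qbar => φ.fieldRange) φ) ⟨x, rfl⟩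
  have hE'K : E' ≤ K := by
    rw [hE', ← InfiniteGalois.fixedField_fixingSubgroup K]
    exact IntermediateField.fixedField_antitone hKH
  have hfin : FiniteDimensional ℚ E' :=
    FiniteDimensional.of_injective (IntermediateField.inclusion hE'K).toLinearMap
      (IntermediateField.inclusion hE'K).injective
  have hopen : IsOpen (H : Set (Qbar ≃ₐ[ℚ] Qbar)) :=
    Subgroup.isOpen_mono hKH (IntermediateField.fixingSubgroup_isOpen K)
  have hclosed : IsClosed (H : Set (Qbar ≃ₐ[ℚ] Qbar)) := Subgroup.isClosed_of_isOpen H hopen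
  have hfixE : E'.fixingSubgroup = H := by
    rw [hE']
    exact InfiniteGalois.fixingSubgroup_fixedField (⟨H, hclosed⟩ : ClosedSubgroup _)
  have hcH : qbarC ∉ H := by
    intro hc
    have : IsAlgClosed Qbar := IsAlgClosure.isAlgClosed ℚ
    obtain ⟨φ⟩ : Nonempty (E →ₐ[ℚ] Qbar) := ⟨IsAlgClosed.lift⟩
    have h1 := hΦ φ
    have h2 : qbarC • φ ∈ Φ ↔ φ ∈ Φ := by
      conv_lhs => rw [← (MulAction.mem_stabilizer_iff.mp hc)]
      exact Set.smul_mem_smul_set_iff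
    have h3 : qbarC • φ = qbarConj.comp φ := rfl
    rw [h3] at h2
    tauto
  obtain ⟨x₀, hx₀, hne⟩ : ∃ x ∈ E', qbarC x ≠ x := by
    by_contra! hcon
    exact hcH (hfixE ▸ (IntermediateField.mem_fixingSubgroup_iff _ _).mpr hcon)
  refine ⟨hfin, ?_, ?_⟩
  · intro ψ
    obtain ⟨g, hg⟩ := exists_gal_extend E' ψ
    refine ⟨⟨x₀, hx₀⟩, fun r hr => hne (g.injective ?_)⟩
    rw [← hcomm g x₀ hx₀]
    apply Subtype.ext
    have h := hg ⟨x₀, hx₀⟩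
    rw [hr] at h
    change (r : ℂ) = ((g x₀ : Qbar) : ℂ) at h
    rw [qbarC_apply, qbarConj_coe, ← h, Complex.conj_ofReal]
  · let c₀ : E' →ₐ[ℚ] E' :=
      ((qbarC : Qbar →ₐ[ℚ] Qbar).comp E'.val).codRestrict E'.toSubalgebra
        (fun x => hcE x x.2)
    have hc₀ : ∀ x : E', ((c₀ x : E') : Qbar) = qbarC x := fun x => rfl
    have hcc : ∀ x, c₀ (c₀ x) = x := fun x => Subtype.ext (by
      rw [hc₀, hc₀]; exact qbarConj_invol _)
    let c : E' ≃ₐ[ℚ] E' := AlgEquiv.ofAlgHom c₀ c₀ (AlgHom.ext hcc) (AlgHom.ext hcc)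
    have hc : ∀ x : E', ((c x : E') : Qbar) = qbarC x := fun x => rfl
    have hord : orderOf c = 2 := by
      refine orderOf_eq_prime ?_ ?_
      · rw [pow_two]; exact AlgEquiv.ext hcc
      · intro h1
        apply hne
        have := hc ⟨x₀, hx₀⟩
        rw [h1] at this
        exact this.symm
    refine ⟨IntermediateField.fixedField (Subgroup.zpowers c), ?_, ?_⟩
    · intro ψ x
      obtain ⟨ψ', hψ'⟩ := IsAlgClosed.surjective_domRestrict_of_isAlgebraic
        (K := ℚ) (L := IntermediateField.fixedField (Subgroup.zpowers c)) (M := ℂ) (E := E')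
        ψ.toRatAlgHom
      obtain ⟨g, hg⟩ := exists_gal_extend E' (ψ' : E' →+* ℂ)
      have h1 : ψ x = ((g ((x : E') : Qbar) : Qbar) : ℂ) := by
        rw [← hg]
        exact (DFunLike.congr_fun hψ' x).symm
      have hx : c (x : E') = x :=
        (IntermediateField.mem_fixedField_iff _ _).mp x.2 c (Subgroup.mem_zpowers c)
      have h2 : qbarC ((x : E') : Qbar) = (x : E') := by rw [← hc, hx]
      have h3 := hcomm g _ (x : E').2
      rw [h2] at h3
      rw [← Complex.conj_eq_iff_real, h1]
      exact congrArg Subtype.val h3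
    · rw [IntermediateField.finrank_fixedField_eq_card, Nat.card_zpowers, hord]
end

section
/- Let (V, Q) be a finite-dimensional real quadratic space with polar form [x,y] = Q(x+y) − Q(x) − Q(y), and let z = x + iy ∈ V_ℂ = V ⊗_ℝ ℂ with x, y ∈ V. If Q_ℂ(z) = 0 and [z, z̄]_ℂ < 0 (where z̄ = x − iy, and Q_ℂ, [·,·]_ℂ are the ℂ-bilinear extensions), then [x, y] = 0, Q(x) = Q(y) < 0, the vectors x and y are linearly independent over ℝ, and the plane ℝx + ℝy is negative definite for Q. -/
open scoped TensorProduct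

lemma aux_value {V : Type*} [AddCommGroup V] [Module ℝ V]
    (Q : QuadraticForm ℝ V) (x y : V) (c : ℂ) :
    Q.baseChange ℂ ((1 : ℂ) ⊗ₜ[ℝ] x + c ⊗ₜ[ℝ] y)
      = (Q x : ℂ) + (Q y : ℂ) * (c * c) + ((QuadraticMap.polar (⇑Q) x y : ℝ) : ℂ) * c := by
  have hp : QuadraticMap.polar (⇑(Q.baseChange ℂ)) ((1 : ℂ) ⊗ₜ[ℝ] x) (c ⊗ₜ[ℝ] y)
      = ((QuadraticMap.polar (⇑Q) x y : ℝ) : ℂ) * c := by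
    have h := congrArg (fun B => B ((1 : ℂ) ⊗ₜ[ℝ] x) (c ⊗ₜ[ℝ] y))
      (QuadraticForm.polarBilin_baseChange (A := ℂ) Q)
    simpa using h
  rw [QuadraticMap.map_add (Q.baseChange ℂ), hp, QuadraticForm.baseChange_tmul,
    QuadraticForm.baseChange_tmul]
  simp

lemma aux_real {V : Type*} [AddCommGroup V] [Module ℝ V]
    (Q : QuadraticForm ℝ V) (x y : V) (a b : ℝ) :
    Q (a • x + b • y) = a * a * Q x + b * b * Q y + a * b * QuadraticMap.polar (⇑Q) x y := by
  rw [QuadraticMap.map_add Q, QuadraticMap.map_smul, QuadraticMap.map_smul,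
    QuadraticMap.polar_smul_left, QuadraticMap.polar_smul_right]
  simp only [smul_eq_mul]
  ring

/-- **Negative definite planes from points of the hermitian domain.**
Let `(V, Q)` be a finite-dimensional real quadratic space and `z = x + iy ∈ V_ℂ = ℂ ⊗[ℝ] V`
(with conjugate `w = z̄ = x − iy`).  If `Q_ℂ(z) = 0` and `[z, z̄]_ℂ` is a negative real number,
then `[x, y] = 0`, `Q(x) = Q(y) < 0`, the vectors `x, y` are linearly independent over `ℝ`,
and the plane `ℝx + ℝy` is negative definite for `Q`. -/
theorem negative_definite_plane_of_isotropic
    {V : Type*} [AddCommGroup V] [Module ℝ V] [FiniteDimensional ℝ V]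
    (Q : QuadraticForm ℝ V) (x y : V) (z w : ℂ ⊗[ℝ] V)
    (hz : z = (1 : ℂ) ⊗ₜ[ℝ] x + Complex.I ⊗ₜ[ℝ] y)
    (hw : w = (1 : ℂ) ⊗ₜ[ℝ] x - Complex.I ⊗ₜ[ℝ] y)
    (hiso : Q.baseChange ℂ z = 0)
    (hneg : ∃ r : ℝ, r < 0 ∧ QuadraticMap.polar (⇑(Q.baseChange ℂ)) z w = (r : ℂ)) :
    QuadraticMap.polar (⇑Q) x y = 0 ∧ Q x = Q y ∧ Q x < 0 ∧
      LinearIndependent ℝ ![x, y] ∧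
      ∀ v ∈ Submodule.span ℝ ({x, y} : Set V), v ≠ 0 → Q v < 0 := by
  obtain ⟨r, hr, hpol⟩ := hneg
  have hw' : w = (1 : ℂ) ⊗ₜ[ℝ] x + (-Complex.I) ⊗ₜ[ℝ] y := by
    rw [hw, TensorProduct.neg_tmul, sub_eq_add_neg]
  have hzw : z + w = (2 : ℂ) ⊗ₜ[ℝ] x := by
    rw [hz, hw, ← one_add_one_eq_two, TensorProduct.add_tmul]
    abel
  have h1 := hiso
  rw [hz, aux_value] at h1
  have hre := congrArg Complex.re h1
  have him := congrArg Complex.im h1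
  simp at hre him
  have hxy : Q x = Q y := by linarith
  rw [QuadraticMap.polar, hzw, hiso, hw', aux_value, QuadraticForm.baseChange_tmul, him, hxy] at hpol
  have h2 := congrArg Complex.re hpol
  simp at h2
  have hy : Q y < 0 := by linarith
  have key : ∀ a b : ℝ, Q (a • x + b • y) = (a * a + b * b) * Q y := by
    intro a b
    rw [aux_real, him, hxy]
    ring
  refine ⟨him, hxy, hxy ▸ hy, ?_, ?_⟩
  · rw [LinearIndependent.pair_iff]
    intro a b hab
    have h := key a b
    rw [hab, QuadraticMap.map_zero] at h
    have h3 : a * a + b * b = 0 := by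
      rcases mul_eq_zero.mp h.symm with h | h
      · exact h
      · exact absurd h hy.ne
    exact ⟨by nlinarith [mul_self_nonneg a, mul_self_nonneg b],
      by nlinarith [mul_self_nonneg a, mul_self_nonneg b]⟩
  · intro v hv hv0
    obtain ⟨a, b, rfl⟩ := Submodule.mem_span_pair.mp hv
    rw [key]
    refine mul_neg_of_pos_of_neg ?_ hy
    by_contra hle
    have ha : a = 0 := by nlinarith [mul_self_nonneg a, mul_self_nonneg b]
    have hb : b = 0 := by nlinarith [mul_self_nonneg a, mul_self_nonneg b]
    exact hv0 (by simp [ha, hb])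
end
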